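/- (Integral formula.) Assume 1 < p < ∞, let f₀ be an extremal function for the p-modulus, and assume essinf_M f₀ > 0. Let φ : M → ℝ be measurable with ∫_M |φ|^p dμ < ∞ and esssup_M |φ| < ∞, such that φ is ν_{π(x)}-integrable for μ-almost every x ∈ M, and define φ̂(x) := ∫_M φ dν_{π(x)}; assume also esssup_M |φ̂| < ∞. Then ∫_M f₀^{p−1} φ dμ = ∫_M f₀^p φ̂ dμ. -/

import Mathlib

open MeasureTheory ENNReal Filter

variable {M N : Type*}

/-- `f : M → [0,∞]` is `p`-admissible for a measurable set `S ⊆ N`: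
`f` is measurable, `∫_M f^p dμ < ∞`, and `∫_M f dν_y ≥ 1` for `σ`-a.e. `y ∈ S`. -/
def IsAdmissible [MeasurableSpace M] [MeasurableSpace N]
    (μ : Measure M) (σ : Measure N) (ν : N → Measure M) (p : ℝ)
    (S : Set N) (f : M → ℝ≥0∞) : Prop :=
  Measurable f ∧ (∫⁻ x, f x ^ p ∂μ) < ∞ ∧ ∀ᵐ y ∂σ, y ∈ S → 1 ≤ ∫⁻ x, f x ∂(ν y)

/-- The `p`-modulus of `S ⊆ N`: the infimum of `(∫_M f^p dμ)^{1/p}` over all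
`p`-admissible `f` for `S` (`∞` if there is no admissible function). -/
noncomputable def Modulus [MeasurableSpace M] [MeasurableSpace N]
    (μ : Measure M) (σ : Measure N) (ν : N → Measure M) (p : ℝ) (S : Set N) : ℝ≥0∞ :=
  ⨅ (f : M → ℝ≥0∞) (_ : IsAdmissible μ σ ν p S f), (∫⁻ x, f x ^ p ∂μ) ^ (1 / p)

/-- `f₀` is extremal for the `p`-modulus: admissible for all of `N`, realizing the modulus. -/
def IsExtremal [MeasurableSpace M] [MeasurableSpace N]
    (μ : Measure M) (σ : Measure N) (ν : N → Measure M) (p : ℝ)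
    (f₀ : M → ℝ≥0∞) : Prop :=
  IsAdmissible μ σ ν p Set.univ f₀ ∧
    (∫⁻ x, f₀ x ^ p ∂μ) ^ (1 / p) = Modulus μ σ ν p Set.univ

/-- The perturbation `(a + t b) / (1 + t k)` of `a` is controlled by `2 (a + |b|)`. -/
theorem perturbation_mem_Icc {a b k t : ℝ} (ht : |t| ≤ 1) (htk : |t * k| ≤ 1 / 2)
    (hab : 0 ≤ a + t * b) :
    (a + t * b) / (1 + t * k) ∈ Set.Icc 0 (2 * (a + |b|)) := by
  have hd : 1 / 2 ≤ 1 + t * k := by linarith [neg_abs_le (t * k)]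
  have hb : t * b ≤ |b| := calc
    t * b ≤ |t| * |b| := by rw [← abs_mul]; exact le_abs_self _
    _ ≤ |b| := mul_le_of_le_one_left (abs_nonneg b) ht
  refine ⟨by positivity, ?_⟩
  rw [div_le_iff₀ (by linarith)]
  nlinarith

theorem hasDerivAt_perturbation_rpow {a b k t p : ℝ} (hp : 1 ≤ p) (hd : 1 + t * k ≠ 0) :
    HasDerivAt (fun s => ((a + s * b) / (1 + s * k)) ^ p)
      ((b - (a + t * b) / (1 + t * k) * k) / (1 + t * k) * p *
        ((a + t * b) / (1 + t * k)) ^ (p - 1)) t := by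
  have h₁ : HasDerivAt (fun s => a + s * b) b t := by
    simpa using ((hasDerivAt_id t).mul_const b).const_add a
  have h₂ : HasDerivAt (fun s => 1 + s * k) k t := by
    simpa using ((hasDerivAt_id t).mul_const k).const_add 1
  have h₃ : HasDerivAt (fun s => (a + s * b) / (1 + s * k)) _ t := h₁.div h₂ hd
  convert h₃.rpow_const (p := p) (Or.inr hp) using 3
  field_simp

theorem abs_deriv_perturbation_rpow_le {a b k K t p : ℝ} (hp : 1 ≤ p) (ha : 0 ≤ a)
    (ht : |t| ≤ 1) (htk : |t * k| ≤ 1 / 2) (hk : |k| ≤ K) (hab : 0 ≤ a + t * b) :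
    |(b - (a + t * b) / (1 + t * k) * k) / (1 + t * k) * p *
        ((a + t * b) / (1 + t * k)) ^ (p - 1)| ≤ p * (1 + 2 * K) * (2 * (a + |b|)) ^ p := by
  obtain ⟨h0, h1⟩ := perturbation_mem_Icc ht htk hab
  have hd : 1 / 2 ≤ 1 + t * k := by linarith [neg_abs_le (t * k)]
  set u := (a + t * b) / (1 + t * k)
  set G := 2 * (a + |b|) with hG
  have hG0 : 0 ≤ G := by positivity
  have hu : |u| ≤ G := by rwa [abs_of_nonneg h0]
  have hnum : |(b - u * k) / (1 + t * k)| ≤ (1 + 2 * K) * G := by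
    rw [abs_div, abs_of_pos (show 0 < 1 + t * k by linarith), div_le_iff₀ (by linarith)]
    have h3 : |u * k| ≤ G * K := by
      rw [abs_mul]
      exact mul_le_mul hu hk (abs_nonneg _) hG0
    have h4 : |b - u * k| ≤ |b| + |u * k| := abs_sub _ _
    have hK : 0 ≤ K := (abs_nonneg k).trans hk
    have h5 : 0 ≤ (1 + 2 * K) * G := by positivity
    nlinarith
  have hpow : u ^ (p - 1) ≤ G ^ (p - 1) := Real.rpow_le_rpow h0 h1 (by linarith)
  have hsplit : G ^ p = G ^ (p - 1) * G := by
    rw [← Real.rpow_add_one' hG0 (by linarith)]; simp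
  have hnum0 : 0 ≤ (1 + 2 * K) * G := (abs_nonneg _).trans hnum
  have hp0 : 0 ≤ p := by linarith
  rw [abs_mul, abs_mul, abs_of_nonneg (show 0 ≤ p by linarith),
    abs_of_nonneg (Real.rpow_nonneg h0 _), hsplit]
  calc _ ≤ (1 + 2 * K) * G * p * G ^ (p - 1) := by gcongr
    _ = _ := by ring

/-- The Euler–Lagrange identity for minimality of `∫ g ^ p` along the perturbations
`(g + t φ) / (1 + t h)`. -/
theorem integral_rpow_mul_eq_of_perturbation_min {M : Type*} [MeasurableSpace M] {μ : Measure M}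
    {p K δ : ℝ} (hp : 1 < p) {g φ h : M → ℝ} (hg : Measurable g) (hφ : Measurable φ)
    (hh : Measurable h) (hg0 : ∀ x, 0 ≤ g x)
    (hint : Integrable (fun x => (2 * (g x + |φ x|)) ^ p) μ)
    (hhK : ∀ᵐ x ∂μ, |h x| ≤ K) (hδ : 0 < δ) (hδ1 : δ ≤ 1) (hδK : δ * K ≤ 1 / 2)
    (hpos : ∀ᵐ x ∂μ, ∀ t, |t| ≤ δ → 0 ≤ g x + t * φ x)
    (hmin : ∀ t, |t| ≤ δ → ∫ x, g x ^ p ∂μ ≤ ∫ x, ((g x + t * φ x) / (1 + t * h x)) ^ p ∂μ) :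
    ∫ x, g x ^ (p - 1) * φ x ∂μ = ∫ x, g x ^ p * h x ∂μ := by
  have hball : ∀ t ∈ Metric.ball (0 : ℝ) δ, |t| ≤ δ := fun t ht => by
    simpa using (Metric.mem_ball.1 ht).le
  have htk : ∀ {k t : ℝ}, |t| ≤ δ → |k| ≤ K → |t * k| ≤ 1 / 2 := fun ht hk => by
    rw [abs_mul]
    exact (mul_le_mul ht hk (abs_nonneg _) hδ.le).trans hδK
  have hgp : Integrable (fun x => g x ^ p) μ := by
    refine hint.mono' (hg.pow_const p).aestronglyMeasurable (.of_forall fun x => ?_)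
    have := hg0 x
    rw [Real.norm_of_nonneg (by positivity)]
    exact Real.rpow_le_rpow this (by linarith [abs_nonneg (φ x)]) (by linarith)
  have hderiv := hasDerivAt_integral_of_dominated_loc_of_deriv_le (μ := μ) (x₀ := (0 : ℝ))
    (F := fun t x => ((g x + t * φ x) / (1 + t * h x)) ^ p)
    (F' := fun t x => (φ x - (g x + t * φ x) / (1 + t * h x) * h x) / (1 + t * h x) * p *
        ((g x + t * φ x) / (1 + t * h x)) ^ (p - 1))
    (bound := fun x => p * (1 + 2 * K) * (2 * (g x + |φ x|)) ^ p)
    (Metric.ball_mem_nhds 0 hδ)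
    (.of_forall fun t => Measurable.aestronglyMeasurable <|
      ((hg.add (hφ.const_mul t)).div ((hh.const_mul t).const_add 1)).pow_const p)
    (by simpa using hgp)
    (Measurable.aestronglyMeasurable (by fun_prop))
    (by
      filter_upwards [hhK, hpos] with x hx hx' t ht
      exact abs_deriv_perturbation_rpow_le hp.le (hg0 x) ((hball t ht).trans hδ1)
        (htk (hball t ht) hx) hx (hx' t (hball t ht)))
    (hint.const_mul _)
    (by
      filter_upwards [hhK] with x hx t ht
      refine hasDerivAt_perturbation_rpow hp.le ?_
      have := htk (hball t ht) hx
      linarith [neg_abs_le (t * h x)])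
  have hloc : IsLocalMin (fun t => ∫ x, ((g x + t * φ x) / (1 + t * h x)) ^ p ∂μ) 0 := by
    filter_upwards [Metric.ball_mem_nhds 0 hδ] with t ht
    simpa using hmin t (hball t ht)
  have hzero := hloc.hasDerivAt_eq_zero hderiv.2
  have hpt : ∀ x, (φ x - (g x + 0 * φ x) / (1 + 0 * h x) * h x) / (1 + 0 * h x) * p *
        ((g x + 0 * φ x) / (1 + 0 * h x)) ^ (p - 1) =
      p * (g x ^ (p - 1) * φ x - g x ^ p * h x) := fun x => by
    have : g x ^ p = g x ^ (p - 1) * g x := by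
      rw [← Real.rpow_add_one' (hg0 x) (by linarith)]; simp
    rw [this]
    simp only [zero_mul, add_zero, div_one]
    ring
  have hi₁ : Integrable (fun x => g x ^ (p - 1) * φ x - g x ^ p * h x) μ := by
    have := hderiv.1.const_mul p⁻¹
    simp only [hpt] at this
    refine this.congr (.of_forall fun x => ?_)
    field_simp
  have hi₂ : Integrable (fun x => g x ^ p * h x) μ :=
    hgp.mul_bdd hh.aestronglyMeasurable hhK
  have hi₃ : Integrable (fun x => g x ^ (p - 1) * φ x) μ := by
    refine (hi₁.add hi₂).congr (.of_forall fun x => ?_)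
    simp
  simp only [hpt, integral_const_mul, integral_sub hi₃ hi₂] at hzero
  have hp0 : p ≠ 0 := by linarith
  have := (mul_eq_zero.1 hzero).resolve_left hp0
  linarith

/-- Dividing by `1 + t ∫ φ` keeps the total mass of a perturbation at least `1`. -/
theorem one_le_lintegral_perturbation {M : Type*} [MeasurableSpace M] {m : Measure M}
    {g φ : M → ℝ} (hg : Measurable g) (hφ : Integrable φ m) (hg0 : ∀ x, 0 ≤ g x) {t : ℝ}
    (hd : 0 < 1 + t * ∫ x, φ x ∂m) (hpos : ∀ᵐ x ∂m, 0 ≤ g x + t * φ x)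
    (hone : 1 ≤ ∫⁻ x, ENNReal.ofReal (g x) ∂m) :
    1 ≤ ∫⁻ x, ENNReal.ofReal ((g x + t * φ x) / (1 + t * ∫ z, φ z ∂m)) ∂m := by
  set d := 1 + t * ∫ x, φ x ∂m with hd'
  have hm : AEStronglyMeasurable (fun x => (g x + t * φ x) / d) m :=
    ((hg.aestronglyMeasurable.add (hφ.1.const_mul t)).mul_const d⁻¹).congr
      (.of_forall fun x => (div_eq_mul_inv _ _).symm)
  have h0 : 0 ≤ᵐ[m] fun x => (g x + t * φ x) / d := by
    filter_upwards [hpos] with x hx using div_nonneg hx hd.le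
  by_cases htop : ∫⁻ x, ENNReal.ofReal ((g x + t * φ x) / d) ∂m = ∞
  · simp [htop]
  have hi := (lintegral_ofReal_ne_top_iff_integrable hm h0).1 htop
  have hgi : Integrable g m := by
    refine ((hi.const_mul d).sub (hφ.const_mul t)).congr (.of_forall fun x => ?_)
    simp only [Pi.sub_apply]
    field_simp
    ring
  rw [← ofReal_integral_eq_lintegral_ofReal hgi (.of_forall hg0), ENNReal.one_le_ofReal] at hone
  rw [← ofReal_integral_eq_lintegral_ofReal hi h0, ENNReal.one_le_ofReal, integral_div,
    integral_add hgi (hφ.const_mul t), integral_const_mul, one_le_div hd]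
  linarith

theorem ae_ae_of_disintegration {M N : Type*} [MeasurableSpace M] [MeasurableSpace N]
    {μ : Measure M} {σ : Measure N} {ν : N → Measure M} (hν : Measurable ν)
    {J : M → ℝ≥0∞} (hJ : Measurable J) (hJtop : ∀ x, J x < ∞)
    (hFubini : ∀ f : M → ℝ≥0∞, Measurable f →
      ∫⁻ x, f x ∂μ = ∫⁻ y, (∫⁻ x, f x / J x ∂(ν y)) ∂σ)
    {P : M → Prop} (hP : ∀ᵐ x ∂μ, P x) : ∀ᵐ y ∂σ, ∀ᵐ x ∂(ν y), P x := by
  obtain ⟨A, hPA, hA, hA0⟩ := exists_measurable_superset_of_null (ae_iff.1 hP)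
  have hmeas : Measurable (fun x => A.indicator (1 : M → ℝ≥0∞) x / J x) :=
    (measurable_one.indicator hA).div hJ
  have h := hFubini (A.indicator 1) (measurable_one.indicator hA)
  rw [lintegral_indicator_one hA, hA0] at h
  filter_upwards [(lintegral_eq_zero_iff
    ((Measure.measurable_lintegral hmeas).comp hν)).1 h.symm] with y hy
  filter_upwards [(lintegral_eq_zero_iff hmeas).1 hy] with x hx
  by_contra hPx
  simp [Set.indicator_of_mem (hPA hPx), (hJtop x).ne] at hx

/-- A property of the leaf through `μ`-a.e. point holds for `σ`-a.e. leaf, provided `σ`-a.e. leaf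
has nonzero measure. -/
theorem ae_base_of_ae_comp {M N : Type*} [MeasurableSpace M] [MeasurableSpace N]
    {μ : Measure M} {σ : Measure N} {ν : N → Measure M} (hν : Measurable ν) {π : M → N}
    (hleaf : ∀ᵐ y ∂σ, ∀ᵐ x ∂(ν y), π x = y)
    {J : M → ℝ≥0∞} (hJ : Measurable J) (hJtop : ∀ x, J x < ∞)
    (hFubini : ∀ f : M → ℝ≥0∞, Measurable f →
      ∫⁻ x, f x ∂μ = ∫⁻ y, (∫⁻ x, f x / J x ∂(ν y)) ∂σ)
    (hne : ∀ᵐ y ∂σ, ν y ≠ 0) {P : N → Prop} (hP : ∀ᵐ x ∂μ, P (π x)) : ∀ᵐ y ∂σ, P y := by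
  filter_upwards [ae_ae_of_disintegration hν hJ hJtop hFubini hP, hleaf, hne] with y hy hl hn
  have : (ae (ν y)).NeBot := ae_neBot.2 hn
  obtain ⟨x, hx, rfl⟩ := (hy.and hl).exists
  exact hx

theorem exists_measurable_eq_integral {M N : Type*} [MeasurableSpace M] [MeasurableSpace N]
    {ν : N → Measure M} (hν : Measurable ν) {φ : M → ℝ} (hφ : Measurable φ) :
    ∃ H : N → ℝ, Measurable H ∧ ∀ y, Integrable φ (ν y) → H y = ∫ x, φ x ∂(ν y) :=
  ⟨fun y => (∫⁻ x, ENNReal.ofReal (φ x) ∂(ν y)).toReal -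
      (∫⁻ x, ENNReal.ofReal (-φ x) ∂(ν y)).toReal,
    ((Measure.measurable_lintegral hφ.ennreal_ofReal).comp hν).ennreal_toReal.sub
      ((Measure.measurable_lintegral hφ.neg.ennreal_ofReal).comp hν).ennreal_toReal,
    fun _ hy => (integral_eq_lintegral_pos_part_sub_lintegral_neg_part hy).symm⟩

theorem exists_ae_abs_le_of_essSup_lt_top {M : Type*} [MeasurableSpace M] {μ : Measure M}
    {φ : M → ℝ} (h : essSup (fun x => ENNReal.ofReal |φ x|) μ < ∞) :
    ∃ K, 0 ≤ K ∧ ∀ᵐ x ∂μ, |φ x| ≤ K := by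
  refine ⟨(essSup (fun x => ENNReal.ofReal |φ x|) μ).toReal, ENNReal.toReal_nonneg, ?_⟩
  filter_upwards [ENNReal.ae_le_essSup (μ := μ) fun x => ENNReal.ofReal |φ x|] with x hx
  exact (ENNReal.ofReal_le_iff_le_toReal h.ne).1 hx

theorem IsExtremal.lintegral_rpow_le {M N : Type*} [MeasurableSpace M] [MeasurableSpace N]
    {μ : Measure M} {σ : Measure N} {ν : N → Measure M} {p : ℝ} (hp : 0 < p)
    {f₀ f : M → ℝ≥0∞} (hf₀ : IsExtremal μ σ ν p f₀) (hf : IsAdmissible μ σ ν p Set.univ f) :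
    ∫⁻ x, f₀ x ^ p ∂μ ≤ ∫⁻ x, f x ^ p ∂μ := by
  rw [← ENNReal.rpow_le_rpow_iff (one_div_pos.2 hp), hf₀.2]
  exact iInf₂_le f hf

theorem statement_15
    {M N : Type*} [MeasurableSpace M] [MeasurableSpace N]
    (μ : Measure M) (σ : Measure N) [SigmaFinite μ] [SigmaFinite σ]
    (ν : N → Measure M) (hνsf : ∀ y, SigmaFinite (ν y))
    (hker : ∀ A : Set M, MeasurableSet A → Measurable fun y => ν y A)
    (p : ℝ) (hp : 1 < p)
    (π : M → N) (hπ : Measurable π)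
    (hleaf : ∀ᵐ y ∂σ, ν y (Set.univ \ π ⁻¹' {y}) = 0)
    (J : M → ℝ≥0∞) (hJ : Measurable J) (hJ0 : ∀ x, 0 < J x) (hJtop : ∀ x, J x < ∞)
    (hFubini : ∀ f : M → ℝ≥0∞, Measurable f →
      ∫⁻ x, f x ∂μ = ∫⁻ y, (∫⁻ x, f x / J x ∂(ν y)) ∂σ)
    (f₀ : M → ℝ≥0∞) (hf₀ : IsExtremal μ σ ν p f₀) (hinf : 0 < essInf f₀ μ)
    (φ : M → ℝ) (hφm : Measurable φ)
    (hφp : (∫⁻ x, ENNReal.ofReal |φ x| ^ p ∂μ) < ∞)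
    (hφb : essSup (fun x => ENNReal.ofReal |φ x|) μ < ∞)
    (hφint : ∀ᵐ x ∂μ, Integrable φ (ν (π x)))
    (hhatb : essSup (fun x => ENNReal.ofReal |∫ z, φ z ∂(ν (π x))|) μ < ∞) :
    ∫ x, (f₀ x).toReal ^ (p - 1) * φ x ∂μ =
      ∫ x, (f₀ x).toReal ^ p * (∫ z, φ z ∂(ν (π x))) ∂μ := by
  have hν : Measurable ν := Measure.measurable_of_measurable_coe ν hker
  have hp0 : 0 < p := by linarith
  obtain ⟨hf₀m, hf₀p, hf₀one⟩ := hf₀.1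
  have hleaf' : ∀ᵐ y ∂σ, ∀ᵐ x ∂(ν y), π x = y := by
    filter_upwards [hleaf] with y hy
    rw [ae_iff]
    convert hy using 2
    ext x
    simp
  have hne : ∀ᵐ y ∂σ, ν y ≠ 0 := by
    filter_upwards [hf₀one] with y hy h0
    simp [h0] at hy
  obtain ⟨H, hH, hHφ⟩ := exists_measurable_eq_integral hν hφm
  obtain ⟨K, hK, hφK⟩ := exists_ae_abs_le_of_essSup_lt_top hφb
  obtain ⟨L, hL, hhatL⟩ := exists_ae_abs_le_of_essSup_lt_top hhatb
  obtain ⟨c, hc, hcinf⟩ := ENNReal.lt_iff_exists_nnreal_btwn.1 hinf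
  have hc0 : (0 : ℝ) < c := by exact_mod_cast hc
  have hcf₀ : ∀ᵐ x ∂μ, (c : ℝ≥0∞) < f₀ x := ae_lt_of_lt_essInf hcinf
  have hf₀top : ∀ᵐ x ∂μ, f₀ x < ∞ := by
    filter_upwards [ae_lt_top (hf₀m.pow_const p) hf₀p.ne] with x hx
    exact (ENNReal.rpow_lt_top_iff_of_pos hp0).1 hx
  have hHL : ∀ᵐ x ∂μ, |H (π x)| ≤ L := by
    filter_upwards [hhatL, hφint] with x hx hi
    rwa [hHφ _ hi]
  set g : M → ℝ := fun x => (f₀ x).toReal with hg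
  have hgm : Measurable g := hf₀m.ennreal_toReal
  have hg0 : ∀ x, 0 ≤ g x := fun x => ENNReal.toReal_nonneg
  have hgf₀ : ∀ᵐ x ∂μ, ENNReal.ofReal (g x) = f₀ x := by
    filter_upwards [hf₀top] with x hx using ENNReal.ofReal_toReal hx.ne
  obtain ⟨δ, hδ, hδ1, hδK, hδL⟩ : ∃ δ : ℝ, 0 < δ ∧ δ ≤ 1 ∧ δ * K ≤ c ∧ δ * L ≤ 1 / 2 := by
    have h₁ : ∀ {a b : ℝ}, 0 < a → 0 ≤ b → ∀ᶠ δ in nhdsWithin (0 : ℝ) (Set.Ioi 0), δ * b ≤ a := by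
      intro a b ha hb
      have : Tendsto (fun δ : ℝ => δ * b) (nhdsWithin 0 (Set.Ioi 0)) (nhds 0) :=
        tendsto_nhdsWithin_of_tendsto_nhds (by simpa using (continuous_mul_const b).tendsto 0)
      exact this.eventually (ge_mem_nhds ha)
    have h₀ : ∀ᶠ δ in nhdsWithin (0 : ℝ) (Set.Ioi 0), 0 < δ := self_mem_nhdsWithin
    obtain ⟨δ, h⟩ := (h₀.and ((h₁ one_pos zero_le_one).and
      ((h₁ hc0 hK).and (h₁ one_half_pos hL)))).exists
    exact ⟨δ, h.1, by simpa using h.2.1, h.2.2⟩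
  have hpos : ∀ᵐ x ∂μ, ∀ t, |t| ≤ δ → 0 ≤ g x + t * φ x := by
    filter_upwards [hcf₀, hf₀top, hφK] with x h₁ h₂ h₃ t ht
    have hcg : (c : ℝ) ≤ g x := by
      simpa using ENNReal.toReal_mono h₂.ne h₁.le
    have : |t * φ x| ≤ δ * K := by
      rw [abs_mul]
      exact mul_le_mul ht h₃ (abs_nonneg _) hδ.le
    linarith [neg_abs_le (t * φ x)]
  have htL : ∀ {k t : ℝ}, |t| ≤ δ → |k| ≤ L → |t * k| ≤ 1 / 2 := fun ht hk => by
    rw [abs_mul]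
    exact (mul_le_mul ht hk (abs_nonneg _) hδ.le).trans hδL
  have hp_ne : ENNReal.ofReal p ≠ 0 := by simpa using hp0
  have hLp : MemLp (fun x => 2 * (g x + |φ x|)) (ENNReal.ofReal p) μ := by
    have hsum : MemLp g (ENNReal.ofReal p) μ ∧ MemLp φ (ENNReal.ofReal p) μ := by
      refine ⟨⟨hgm.aestronglyMeasurable, ?_⟩, ⟨hφm.aestronglyMeasurable, ?_⟩⟩
      · rw [eLpNorm_lt_top_iff_lintegral_rpow_enorm_lt_top hp_ne ofReal_ne_top,
          toReal_ofReal hp0.le]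
        refine lt_of_eq_of_lt (lintegral_congr_ae ?_) hf₀p
        filter_upwards [hgf₀] with x hx
        rw [Real.enorm_eq_ofReal (hg0 x), hx]
      · rw [eLpNorm_lt_top_iff_lintegral_rpow_enorm_lt_top hp_ne ofReal_ne_top,
          toReal_ofReal hp0.le]
        simpa only [Real.enorm_eq_ofReal_abs] using hφp
    exact (hsum.1.add hsum.2.norm).const_mul 2
  have hint : Integrable (fun x => (2 * (g x + |φ x|)) ^ p) μ := by
    refine (hLp.integrable_norm_rpow hp_ne ofReal_ne_top).congr (.of_forall fun x => ?_)
    have := hg0 x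
    simp only [toReal_ofReal hp0.le]
    rw [Real.norm_of_nonneg (by positivity)]
  have hmin : ∀ t, |t| ≤ δ →
      ∫ x, g x ^ p ∂μ ≤ ∫ x, ((g x + t * φ x) / (1 + t * H (π x))) ^ p ∂μ := by
    intro t ht
    have hum : Measurable fun x => (g x + t * φ x) / (1 + t * H (π x)) :=
      (hgm.add (hφm.const_mul t)).div (((hH.comp hπ).const_mul t).const_add 1)
    have hIcc : ∀ᵐ x ∂μ, (g x + t * φ x) / (1 + t * H (π x)) ∈
        Set.Icc 0 (2 * (g x + |φ x|)) := by
      filter_upwards [hpos, hHL] with x h₁ h₂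
      exact perturbation_mem_Icc (ht.trans hδ1) (htL ht h₂) (h₁ t ht)
    have hupos : 0 ≤ᵐ[μ] fun x => ((g x + t * φ x) / (1 + t * H (π x))) ^ p := by
      filter_upwards [hIcc] with x hx using Real.rpow_nonneg hx.1 p
    have hui : Integrable (fun x => ((g x + t * φ x) / (1 + t * H (π x))) ^ p) μ := by
      refine hint.mono' (hum.pow_const p).aestronglyMeasurable ?_
      filter_upwards [hIcc, hupos] with x hx hx'
      rw [Real.norm_of_nonneg hx']
      exact Real.rpow_le_rpow hx.1 hx.2 hp0.le
    have hulint : ∫⁻ x, ENNReal.ofReal ((g x + t * φ x) / (1 + t * H (π x))) ^ p ∂μ =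
        ENNReal.ofReal (∫ x, ((g x + t * φ x) / (1 + t * H (π x))) ^ p ∂μ) := by
      rw [ofReal_integral_eq_lintegral_ofReal hui hupos]
      refine lintegral_congr_ae ?_
      filter_upwards [hIcc] with x hx using ENNReal.ofReal_rpow_of_nonneg hx.1 hp0.le
    have hgi : Integrable (fun x => g x ^ p) μ := by
      refine hint.mono' (hgm.pow_const p).aestronglyMeasurable (.of_forall fun x => ?_)
      rw [Real.norm_of_nonneg (Real.rpow_nonneg (hg0 x) p)]
      exact Real.rpow_le_rpow (hg0 x) (by linarith [abs_nonneg (φ x), hg0 x]) hp0.le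
    have hglint : ∫⁻ x, f₀ x ^ p ∂μ = ENNReal.ofReal (∫ x, g x ^ p ∂μ) := by
      rw [ofReal_integral_eq_lintegral_ofReal hgi
        (.of_forall fun x => Real.rpow_nonneg (hg0 x) p)]
      refine lintegral_congr_ae ?_
      filter_upwards [hgf₀] with x hx
      rw [← ENNReal.ofReal_rpow_of_nonneg (hg0 x) hp0.le, hx]
    have hadm : IsAdmissible μ σ ν p Set.univ
        fun x => ENNReal.ofReal ((g x + t * φ x) / (1 + t * H (π x))) := by
      refine ⟨hum.ennreal_ofReal, hulint ▸ ofReal_lt_top, ?_⟩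
      filter_upwards [hf₀one, hleaf',
        ae_base_of_ae_comp hν hleaf' hJ hJtop hFubini hne (P := fun y => Integrable φ (ν y)) hφint,
        ae_base_of_ae_comp hν hleaf' hJ hJtop hFubini hne (P := fun y => |H y| ≤ L) hHL,
        ae_ae_of_disintegration hν hJ hJtop hFubini hpos,
        ae_ae_of_disintegration hν hJ hJtop hFubini hgf₀] with y hone hy hφy hHy hposy hgy _
      have hd : 0 < 1 + t * ∫ x, φ x ∂(ν y) := by
        have := htL ht hHy
        rw [hHφ y hφy] at this
        linarith [neg_abs_le (t * ∫ x, φ x ∂(ν y))]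
      refine (one_le_lintegral_perturbation hgm hφy hg0 hd
        (hposy.mono fun x hx => hx t ht) ?_).trans_eq (lintegral_congr_ae ?_)
      · rw [lintegral_congr_ae hgy]
        exact hone (Set.mem_univ y)
      · filter_upwards [hy] with x hx
        rw [hx, hHφ y hφy]
    have hle := hf₀.lintegral_rpow_le hp0 hadm
    rwa [hglint, hulint, ENNReal.ofReal_le_ofReal_iff (integral_nonneg_of_ae hupos)] at hle
  rw [integral_rpow_mul_eq_of_perturbation_min hp hgm hφm (hH.comp hπ) hg0 hint hHL hδ hδ1 hδL
    hpos hmin]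
  refine integral_congr_ae ?_
  filter_upwards [hφint] with x hx
  simp only [Function.comp_apply, hHφ _ hx]
  rfl
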